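/- Let n = 2k+1 with k ≥ 1. The characteristic polynomial of the adjacency matrix M_n of the middle-cube graph equals ∏_{i=1}^{k+1} (λ − i)^{C(n, k+1−i) − C(n, k−i)} · (λ + i)^{C(n, k+1−i) − C(n, k−i)}, where C(n, −1) = 0. -/

import Mathlib

open Finset

/-- Vertices of the middle-cube `M_n` (with `n = 2k+1`): subsets of `S = {1,…,n}`
(modeled as `Fin n`) of cardinality `k` or `k+1`. -/
abbrev MidVert (n k : ℕ) := {A : Finset (Fin n) // A.card = k ∨ A.card = k + 1}

/-- Adjacency matrix of the middle-cube: two distinct vertices `A`, `B` are adjacent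
iff `A ⊂ B` or `B ⊂ A`. -/
def midAdj (n k : ℕ) : Matrix (MidVert n k) (MidVert n k) ℝ :=
  fun A B => if A.1 ⊂ B.1 ∨ B.1 ⊂ A.1 then 1 else 0

/-- Binomial coefficient `C(n, j)` for an integer `j`, with `C(n, j) = 0` for `j < 0`. -/
def binom (n : ℕ) (j : ℤ) : ℕ := if 0 ≤ j then n.choose j.toNat else 0

/-- The subsets of `Fin n` of cardinality `j`. -/
abbrev Layer (n j : ℕ) := {A : Finset (Fin n) // A.card = j}

/-- The inclusion matrix between two consecutive layers of the Boolean lattice. -/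
def inclMatrix (n j : ℕ) : Matrix (Layer n (j + 1)) (Layer n j) ℝ :=
  fun A B => if B.1 ⊆ A.1 then 1 else 0

lemma card_layer (n j : ℕ) : Fintype.card (Layer n j) = n.choose j := by
  simp [Layer]

lemma card_supersets {n m : ℕ} (hm : m ≤ n) (S : Finset (Fin n)) :
    #{C : Finset (Fin n) | C.card = m ∧ S ⊆ C} = (n - S.card).choose (n - m) := by
  have h : (n - S.card).choose (n - m) = #(powersetCard (n - m) Sᶜ) := by
    simp [card_compl]
  rw [h]
  refine Finset.card_nbij' (fun C => Cᶜ) (fun C => Cᶜ) ?_ ?_ ?_ ?_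
  · intro C hC
    simp only [coe_filter, mem_univ, true_and, Set.mem_ofPred_eq] at hC
    simp [mem_powersetCard, card_compl, hC.1, hC.2]
  · intro C hC
    simp only [mem_coe, mem_powersetCard] at hC
    have hSC : S ⊆ Cᶜ := by
      rw [← compl_subset_compl, compl_compl]
      exact hC.1
    simp [card_compl, hC.2, hSC, Nat.sub_sub_self hm]
  · exact fun C _ => compl_compl C
  · exact fun C _ => compl_compl C

lemma inclMatrix_transpose_mul_apply (n j : ℕ) (hj : j + 1 ≤ n) (A B : Layer n j) :
    ((inclMatrix n j).transpose * inclMatrix n j) A B =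
      ((n - (A.1 ∪ B.1).card).choose (n - (j + 1)) : ℕ) := by
  rw [← card_supersets hj, Matrix.mul_apply]
  simp only [Matrix.transpose_apply, inclMatrix, ← ite_and, mul_ite, mul_one, mul_zero]
  rw [Finset.sum_boole, ← Finset.card_map (Function.Embedding.subtype _)]
  congr 2
  ext C
  simp only [mem_map, mem_filter, mem_univ, true_and, Function.Embedding.subtype_apply,
    Subtype.exists, exists_and_right, exists_eq_right, union_subset_iff]
  tauto

lemma inclMatrix_mul_transpose_apply (n j : ℕ) (A B : Layer n (j + 1)) :
    (inclMatrix n j * (inclMatrix n j).transpose) A B = ((A.1 ∩ B.1).card.choose j : ℕ) := by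
  rw [← card_powersetCard, Matrix.mul_apply]
  simp only [Matrix.transpose_apply, inclMatrix, ← ite_and, mul_ite, mul_one, mul_zero]
  rw [Finset.sum_boole, ← Finset.card_map (Function.Embedding.subtype _)]
  congr 2
  ext C
  simp only [mem_map, mem_filter, mem_univ, true_and, Function.Embedding.subtype_apply,
    Subtype.exists, exists_and_right, exists_eq_right, subset_inter_iff, mem_powersetCard]
  tauto

/-- The commutation relation between the up and down operators of the Boolean lattice. -/
lemma inclMatrix_commutation (n j : ℕ) (hj : j + 2 ≤ n) :
    (inclMatrix n (j + 1)).transpose * inclMatrix n (j + 1) =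
      inclMatrix n j * (inclMatrix n j).transpose -
        Matrix.scalar (Layer n (j + 1)) (2 * ((j : ℝ) + 1) - n) := by
  ext A B
  rw [Matrix.sub_apply, inclMatrix_transpose_mul_apply n (j + 1) hj,
    inclMatrix_mul_transpose_apply, Matrix.scalar_apply, Matrix.diagonal_apply]
  have hcard := card_union_add_card_inter A.1 B.1
  rw [A.2, B.2] at hcard
  by_cases hAB : A = B
  · subst hAB
    obtain ⟨d, rfl⟩ := Nat.exists_eq_add_of_le hj
    have h1 : j + 2 + d - (j + 1) = d + 1 := by omega
    simp only [union_self, inter_self, A.2, h1, Nat.add_sub_cancel_left, if_true,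
      Nat.choose_succ_self_right]
    push_cast
    ring
  · have hlt : (A.1 ∩ B.1).card < j + 1 := by
      refine lt_of_lt_of_eq ?_ A.2
      refine card_lt_card (inter_subset_left.ssubset_of_ne fun h => hAB ?_)
      have hsub : A.1 ⊆ B.1 := inter_eq_left.mp h
      exact Subtype.ext (eq_of_subset_of_card_le hsub (by rw [A.2, B.2]))
    simp only [hAB, if_false, sub_zero, Nat.cast_inj]
    rcases Nat.lt_succ_iff_lt_or_eq.mp hlt with h | h
    · rw [Nat.choose_eq_zero_of_lt h, Nat.choose_eq_zero_of_lt]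
      have := card_le_univ (A.1 ∪ B.1)
      rw [Fintype.card_fin] at this
      omega
    · rw [h, show (A.1 ∪ B.1).card = j + 1 + 1 by omega, Nat.choose_self, Nat.choose_self]

lemma charpoly_inclMatrix_zero (n : ℕ) (hn : 1 ≤ n) :
    ((inclMatrix n 0).transpose * inclMatrix n 0).charpoly =
      Polynomial.X - Polynomial.C (n : ℝ) := by
  have hc : Fintype.card (Layer n 0) = 1 := by rw [card_layer, Nat.choose_zero_right]
  rw [Matrix.charpoly, Matrix.det_eq_elem_of_card_eq_one hc ⟨∅, rfl⟩, Matrix.charmatrix_apply_eq,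
    inclMatrix_transpose_mul_apply n 0 hn]
  obtain ⟨m, rfl⟩ := Nat.exists_eq_add_of_le' hn
  simp

lemma charpoly_inclMatrix_succ (n j : ℕ) (hj : 2 * (j + 1) ≤ n) :
    ((inclMatrix n (j + 1)).transpose * inclMatrix n (j + 1)).charpoly =
      (Polynomial.X ^ (n.choose (j + 1) - n.choose j) *
        ((inclMatrix n j).transpose * inclMatrix n j).charpoly).comp
          (Polynomial.X + Polynomial.C (2 * ((j : ℝ) + 1) - n)) := by
  rw [inclMatrix_commutation n j (by omega), Matrix.charpoly_sub_scalar,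
    Matrix.charpoly_mul_comm_of_le, card_layer, card_layer]
  rw [card_layer, card_layer]
  exact Nat.choose_le_succ_of_lt_half_left (by omega)

lemma binom_natCast (n j : ℕ) : binom n j = n.choose j := by
  simp [binom]

lemma charpoly_inclMatrix (n j : ℕ) (hn : 1 ≤ n) (hj : 2 * j ≤ n) :
    ((inclMatrix n j).transpose * inclMatrix n j).charpoly =
      ∏ i ∈ range (j + 1),
        (Polynomial.X - Polynomial.C (((j : ℝ) - i + 1) * ((n : ℝ) - i - j))) ^
          (binom n i - binom n ((i : ℤ) - 1)) := by
  induction j with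
  | zero => simp [charpoly_inclMatrix_zero n hn, binom]
  | succ j ih =>
    have hb : binom n (((j + 1 : ℕ) : ℤ) - 1) = n.choose j := by
      rw [← binom_natCast]
      congr 1
      push_cast
      ring
    rw [charpoly_inclMatrix_succ n j hj, ih (by omega), prod_range_succ _ (j + 1), mul_comm,
      Polynomial.mul_comp, Polynomial.prod_comp, binom_natCast, hb]
    congr 1
    · refine prod_congr rfl fun i _ => ?_
      rw [Polynomial.pow_comp]
      congr 1
      simp only [Polynomial.sub_comp, Polynomial.X_comp, Polynomial.C_comp]
      rw [add_sub_assoc, ← Polynomial.C_sub, sub_eq_add_neg Polynomial.X, ← Polynomial.C_neg]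
      congr 2
      push_cast
      ring
    · rw [Polynomial.pow_comp, Polynomial.X_comp, sub_eq_add_neg Polynomial.X, ← Polynomial.C_neg]
      congr 3
      push_cast
      ring

/-- The characteristic polynomial of a bipartite matrix with colour classes of equal size. -/
lemma charpoly_fromBlocks_zero_transpose {R m l : Type*} [CommRing R] [Fintype m] [Fintype l]
    [DecidableEq m] [DecidableEq l] (h : Fintype.card m = Fintype.card l) (U : Matrix l m R) :
    (Matrix.fromBlocks 0 U.transpose U 0).charpoly =
      (U.transpose * U).charpoly.comp (Polynomial.X ^ 2) := by
  have hmul : Matrix.charmatrix (Matrix.fromBlocks 0 U.transpose U 0) *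
      Matrix.fromBlocks (Matrix.scalar m Polynomial.X) 0 (U.map Polynomial.C) 1 =
      Matrix.fromBlocks
        ((Matrix.charmatrix (U.transpose * U)).map (Polynomial.compRingHom (Polynomial.X ^ 2)))
        (-U.transpose.map Polynomial.C) 0 (Matrix.scalar l Polynomial.X) := by
    rw [Matrix.charmatrix_fromBlocks, Matrix.fromBlocks_multiply]
    congr 1
    · ext i j : 1
      rcases eq_or_ne i j with rfl | hij
      · simp [Matrix.charmatrix, Matrix.mul_apply, sq, sub_eq_add_neg]
      · simp [Matrix.charmatrix, Matrix.mul_apply, hij]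
    · simp
    · ext i j : 1
      simp [Matrix.charmatrix]
    · simp [Matrix.charmatrix]
  have hdet := congrArg Matrix.det hmul
  rw [Matrix.det_mul, Matrix.det_fromBlocks_zero₁₂, Matrix.det_fromBlocks_zero₂₁,
    ← RingHom.mapMatrix_apply, ← RingHom.map_det] at hdet
  simp only [Matrix.scalar_apply, Matrix.det_diagonal, prod_const, card_univ, Matrix.det_one,
    mul_one, h] at hdet
  exact (Polynomial.isRegular_X_pow _).right hdet

/-- The vertices of the middle-cube, split into its two layers. -/
def midVertEquiv (n k : ℕ) : MidVert n k ≃ Layer n k ⊕ Layer n (k + 1) :=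
  subtypeOrEquiv _ _ (by
    rw [Pi.disjoint_iff]
    intro A
    rw [Prop.disjoint_iff]
    simp only [not_and_or]
    omega)

lemma midAdj_submatrix (n k : ℕ) :
    (midAdj n k).submatrix (midVertEquiv n k).symm (midVertEquiv n k).symm =
      Matrix.fromBlocks 0 (inclMatrix n k).transpose (inclMatrix n k) 0 := by
  have key {A B : Finset (Fin n)} (hA : A.card = k) (hB : B.card = k + 1) :
      (A ⊂ B ↔ A ⊆ B) ∧ ¬ B ⊂ A := by
    refine ⟨⟨fun h => h.1, fun h => h.ssubset_of_ne ?_⟩, fun h => ?_⟩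
    · rintro rfl
      omega
    · have := card_lt_card h
      omega
  have same {A B : Finset (Fin n)} (h : A.card = B.card) : ¬ A ⊂ B :=
    fun hAB => (card_lt_card hAB).ne h
  ext (A | A) (B | B)
  · simp [midAdj, midVertEquiv, same (A.2.trans B.2.symm), same (B.2.trans A.2.symm)]
  · simp [midAdj, midVertEquiv, inclMatrix, key A.2 B.2]
  · simp [midAdj, midVertEquiv, inclMatrix, key B.2 A.2]
  · simp [midAdj, midVertEquiv, same (A.2.trans B.2.symm), same (B.2.trans A.2.symm)]

lemma charpoly_midAdj (k : ℕ) :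
    (midAdj (2 * k + 1) k).charpoly =
      ((inclMatrix (2 * k + 1) k).transpose * inclMatrix (2 * k + 1) k).charpoly.comp
        (Polynomial.X ^ 2) := by
  rw [← Matrix.charpoly_reindex (midVertEquiv (2 * k + 1) k), Matrix.reindex_apply,
    midAdj_submatrix, charpoly_fromBlocks_zero_transpose]
  rw [card_layer, card_layer, Nat.choose_symm_half]

/-- The characteristic polynomial of the adjacency matrix of the middle-cube `M_n`
(`n = 2k+1`) equals
`∏_{i=1}^{k+1} (λ − i)^{C(n,k+1−i) − C(n,k−i)} (λ + i)^{C(n,k+1−i) − C(n,k−i)}`. -/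
theorem middle_cube_charpoly (k : ℕ) (hk : 1 ≤ k) :
    (midAdj (2 * k + 1) k).charpoly =
      ∏ i ∈ Finset.Icc 1 (k + 1),
        ((Polynomial.X - Polynomial.C (i : ℝ)) ^
            (binom (2 * k + 1) ((k : ℤ) + 1 - i) - binom (2 * k + 1) ((k : ℤ) - i)) *
          (Polynomial.X + Polynomial.C (i : ℝ)) ^
            (binom (2 * k + 1) ((k : ℤ) + 1 - i) - binom (2 * k + 1) ((k : ℤ) - i))) := by
  rw [charpoly_midAdj, charpoly_inclMatrix _ _ (by omega) (by omega), Polynomial.prod_comp]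
  refine prod_nbij' (fun i => k + 1 - i) (fun i => k + 1 - i) ?_ ?_ ?_ ?_ ?_
  · intro i hi
    simp only [mem_range, mem_Icc] at *
    omega
  · intro i hi
    simp only [mem_range, mem_Icc] at *
    omega
  · intro i hi
    simp only [mem_range] at *
    omega
  · intro i hi
    simp only [mem_Icc] at *
    omega
  · intro i hi
    rw [mem_range] at hi
    rw [show (k : ℤ) + 1 - ((k + 1 - i : ℕ) : ℤ) = i by omega,
      show (k : ℤ) - ((k + 1 - i : ℕ) : ℤ) = i - 1 by omega, ← mul_pow, Polynomial.pow_comp]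
    congr 1
    rw [Nat.cast_sub hi.le]
    simp only [Polynomial.sub_comp, Polynomial.X_comp, Polynomial.C_comp]
    push_cast
    simp only [map_add, map_sub, map_mul, map_one, map_ofNat]
    ring
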